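/- arXiv:2212.12275 — 3 statements merged into one kernel-verified Lean document; each statement's English description precedes it below -/
import Mathlib

section
/- Let M be a simple matroid on [n] and π a permutation of [n]. If C_1 and C_2 are circuits in C^π(M) with |C_1| = |C_2| and C_1 \ {min_{<_π}(C_1)} = C_2 \ {min_{<_π}(C_2)} (i.e., the boundaries ∂(e_{C_1}) and ∂(e_{C_2}) have the same initial monomial with respect to a monomial order ≺_π induced by π), then C_1 = C_2. -/
open ExteriorAlgebra

variable (R : Type*) [CommRing R] (n : ℕ)

/-- The generator `e_i` of the exterior algebra on `n` generators. -/
noncomputable def gen (i : Fin n) : ExteriorAlgebra R (Fin n → R) :=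
  ExteriorAlgebra.ι R (Pi.single i 1)

/-- The monomial `e_X = e_{i_1} ∧ ⋯ ∧ e_{i_m}` for `X = {i_1 < ⋯ < i_m}`. -/
noncomputable def eMon (X : Finset (Fin n)) : ExteriorAlgebra R (Fin n → R) :=
  ((X.sort (· ≤ ·)).map (gen R n)).prod

/-- `∂(e_X) = Σ_k (−1)^{k−1} e_{X \ {i_k}}`. -/
noncomputable def bdry (X : Finset (Fin n)) : ExteriorAlgebra R (Fin n → R) :=
  ∑ i ∈ X, (-1 : ExteriorAlgebra R (Fin n → R)) ^ (X.filter (fun j => j < i)).card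
      * eMon R n (X.erase i)

/-- The degree-`q` graded component `Λ^q` of the exterior algebra. -/
noncomputable def lamGrade (q : ℕ) : Submodule R (ExteriorAlgebra R (Fin n → R)) :=
  LinearMap.range (ι R : (Fin n → R) →ₗ[R] ExteriorAlgebra R (Fin n → R)) ^ q

/-- `Λ⁺`, the span of the elements of strictly positive degree. -/
noncomputable def lamPlus : Submodule R (ExteriorAlgebra R (Fin n → R)) :=
  ⨆ i : ℕ, ⨆ _ : 0 < i, lamGrade R n i

/-- The Orlik–Solomon ideal: the (two-sided) ideal generated by the boundaries of circuits. -/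
noncomputable def osIdeal (𝒞 : Set (Finset (Fin n))) :
    Submodule R (ExteriorAlgebra R (Fin n → R)) :=
  Submodule.span R {x | ∃ a b : ExteriorAlgebra R (Fin n → R), ∃ C ∈ 𝒞, x = a * bdry R n C * b}

/-- The decomposable Orlik–Solomon ideal, the product ideal `Λ⁺ I(M)`. -/
noncomputable def decIdeal (𝒞 : Set (Finset (Fin n))) :
    Submodule R (ExteriorAlgebra R (Fin n → R)) :=
  lamPlus R n * osIdeal R n 𝒞

/-- A circuit of a matroid: a minimal dependent (finite) set. -/
def IsCct (M : Matroid (Fin n)) (C : Finset (Fin n)) : Prop :=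
  M.Dep ↑C ∧ ∀ D : Finset (Fin n), D ⊂ C → ¬ M.Dep ↑D

/-- The set of circuits of `M`. -/
def circuits (M : Matroid (Fin n)) : Set (Finset (Fin n)) := {C | IsCct n M C}

/-- A matroid on ground set `Fin n` (i.e. with `M.E = univ`) is simple iff every
two-element subset is independent. -/
def IsSimple (M : Matroid (Fin n)) : Prop :=
  M.E = Set.univ ∧ ∀ e f : Fin n, M.Indep {e, f}

/-- `a` is the `<_π`-minimal element of `C`. -/
def IsMinP (π : Equiv.Perm (Fin n)) (C : Finset (Fin n)) (a : Fin n) : Prop :=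
  a ∈ C ∧ ∀ b ∈ C, π a ≤ π b

/-- `i` is active with respect to `J` (relative to `<_π`): `J ∪ {i}` contains a circuit
whose `<_π`-minimal element is `i`. -/
def IsActive (M : Matroid (Fin n)) (π : Equiv.Perm (Fin n)) (J : Finset (Fin n))
    (i : Fin n) : Prop :=
  ∃ C : Finset (Fin n), IsCct n M C ∧ C ⊆ insert i J ∧ IsMinP n π C i

/-- `a = α_π(C)`: the `<_π`-smallest element active with respect to `C \ {min_{<_π}(C)}`. -/
def IsAlpha (M : Matroid (Fin n)) (π : Equiv.Perm (Fin n)) (C : Finset (Fin n))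
    (a : Fin n) : Prop :=
  ∃ m, IsMinP n π C m ∧ IsActive n M π (C.erase m) a ∧
    ∀ b, IsActive n M π (C.erase m) b → π a ≤ π b

/-- Condition (1): `C` is a circuit with `min_{<_π}(C) = α_π(C)`. -/
def SatOne (M : Matroid (Fin n)) (π : Equiv.Perm (Fin n)) (C : Finset (Fin n)) : Prop :=
  IsCct n M C ∧ ∃ a, IsMinP n π C a ∧ IsAlpha n M π C a

/-- `C ∈ 𝒞^π(M)`: condition (1) plus inclusion-minimality of `C \ {α_π(C)}`. -/
def InCpi (M : Matroid (Fin n)) (π : Equiv.Perm (Fin n)) (C : Finset (Fin n)) : Prop :=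
  SatOne n M π C ∧
    ∀ C' a a', SatOne n M π C' → IsAlpha n M π C a → IsAlpha n M π C' a' →
      C'.erase a' ⊆ C.erase a → C'.erase a' = C.erase a

theorem IsMinP.unique {π : Equiv.Perm (Fin n)} {C : Finset (Fin n)} {a b : Fin n}
    (ha : IsMinP n π C a) (hb : IsMinP n π C b) : a = b :=
  π.injective (le_antisymm (ha.2 b hb.1) (hb.2 a ha.1))

/-- The minimum of a circuit satisfying condition (1) is the smallest element active with respect
to the rest of the circuit. -/
theorem SatOne.isLeast_active {M : Matroid (Fin n)} {π : Equiv.Perm (Fin n)}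
    {C : Finset (Fin n)} {m : Fin n} (h : SatOne n M π C) (hm : IsMinP n π C m) :
    IsActive n M π (C.erase m) m ∧ ∀ b, IsActive n M π (C.erase m) b → π m ≤ π b := by
  obtain ⟨-, a, ha, m', hm', hact⟩ := h
  obtain rfl := hm.unique n ha
  obtain rfl := hm.unique n hm'
  exact hact

/-- If `C₁, C₂ ∈ C^π(M)` have the same cardinality and
`C₁ \ {min_{<_π}(C₁)} = C₂ \ {min_{<_π}(C₂)}` (i.e. `∂(e_{C₁})` and `∂(e_{C₂})` have the
same initial monomial w.r.t. a monomial order induced by `π`), then `C₁ = C₂`. -/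
theorem stmt_5 (n : ℕ) (hn : 1 ≤ n) (M : Matroid (Fin n)) (hsimple : IsSimple n M)
    (π : Equiv.Perm (Fin n)) (C₁ C₂ : Finset (Fin n)) (m₁ m₂ : Fin n)
    (h₁ : InCpi n M π C₁) (h₂ : InCpi n M π C₂) (hcard : C₁.card = C₂.card)
    (hm₁ : IsMinP n π C₁ m₁) (hm₂ : IsMinP n π C₂ m₂)
    (heq : C₁.erase m₁ = C₂.erase m₂) : C₁ = C₂ := by
  obtain ⟨hact₁, hle₁⟩ := h₁.1.isLeast_active n hm₁
  obtain ⟨hact₂, hle₂⟩ := h₂.1.isLeast_active n hm₂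
  rw [heq] at hact₁ hle₁
  have hm : m₁ = m₂ := π.injective (le_antisymm (hle₁ m₂ hact₂) (hle₂ m₁ hact₁))
  rw [← Finset.insert_erase hm₁.1, ← Finset.insert_erase hm₂.1, heq, hm]
end

section
/- Let M be a simple matroid on ground set [n]. Then the Orlik–Solomon algebra A(M) = Λ/I(M) over ℤ is torsion free: for every degree q, the abelian group A^q(M) is torsion free. -/
open ExteriorAlgebra

variable (R : Type*) [CommRing R] (n : ℕ)

section Monomials

lemma eMon_empty : eMon R n ∅ = 1 := by simp [eMon]

lemma eMon_insert_of_forall_lt {a : Fin n} {s : Finset (Fin n)} (h : ∀ x ∈ s, a < x) :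
    eMon R n (insert a s) = gen R n a * eMon R n s := by
  rw [eMon, Finset.sort_insert _ (fun b hb => (h b hb).le) (fun ha => lt_irrefl a (h a ha)),
    List.map_cons, List.prod_cons, eMon]

lemma gen_mul_self (a : Fin n) : gen R n a * gen R n a = 0 := ExteriorAlgebra.ι_sq_zero _

lemma gen_mul_gen (a b : Fin n) : gen R n a * gen R n b = -(gen R n b * gen R n a) :=
  eq_neg_of_add_eq_zero_left (ExteriorAlgebra.ι_add_mul_swap _ _)

lemma gen_mul_eMon_of_mem {a : Fin n} {s : Finset (Fin n)} (ha : a ∈ s) :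
    gen R n a * eMon R n s = 0 := by
  induction s using Finset.induction_on_min with
  | empty => simp at ha
  | insert b s hb ih =>
    rw [eMon_insert_of_forall_lt R n hb, ← mul_assoc]
    rcases Finset.mem_insert.1 ha with rfl | ha
    · rw [gen_mul_self, zero_mul]
    · rw [gen_mul_gen, neg_mul, mul_assoc, ih ha, mul_zero, neg_zero]

lemma gen_mul_eMon_of_notMem {a : Fin n} {s : Finset (Fin n)} (ha : a ∉ s) :
    ∃ u : ℤˣ, gen R n a * eMon R n s = u • eMon R n (insert a s) := by
  induction s using Finset.induction_on_min with
  | empty => exact ⟨1, by rw [one_smul, eMon_insert_of_forall_lt R n (by simp)]⟩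
  | insert b s hb ih =>
    rw [Finset.mem_insert, not_or] at ha
    rcases lt_or_gt_of_ne ha.1 with hab | hba
    · refine ⟨1, ?_⟩
      rw [one_smul, eMon_insert_of_forall_lt R n (a := a)]
      intro x hx
      rcases Finset.mem_insert.1 hx with rfl | hx
      · exact hab
      · exact hab.trans (hb x hx)
    · obtain ⟨u, hu⟩ := ih ha.2
      refine ⟨-u, ?_⟩
      rw [eMon_insert_of_forall_lt R n hb, ← mul_assoc, gen_mul_gen, neg_mul, mul_assoc, hu,
        Finset.insert_comm, eMon_insert_of_forall_lt R n (a := b), mul_smul_comm, Units.smul_def,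
        Units.smul_def, Units.val_neg, neg_smul]
      intro x hx
      rcases Finset.mem_insert.1 hx with rfl | hx
      · exact hba
      · exact hb x hx

lemma eMon_mul_eMon (s t : Finset (Fin n)) :
    (¬ Disjoint s t ∧ eMon R n s * eMon R n t = 0) ∨
      Disjoint s t ∧ ∃ u : ℤˣ, eMon R n s * eMon R n t = u • eMon R n (s ∪ t) := by
  induction s using Finset.induction_on_min with
  | empty => exact Or.inr ⟨Finset.disjoint_empty_left t, 1, by simp [eMon_empty]⟩
  | insert a s ha ih =>
    rw [eMon_insert_of_forall_lt R n ha, mul_assoc, Finset.disjoint_insert_left]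
    rcases ih with ⟨hd, h⟩ | ⟨hd, u, h⟩
    · exact Or.inl ⟨fun h' => hd h'.2, by rw [h, mul_zero]⟩
    · rw [h, mul_smul_comm]
      by_cases hat : a ∈ t
      · refine Or.inl ⟨fun h' => h'.1 hat, ?_⟩
        rw [gen_mul_eMon_of_mem R n (Finset.mem_union_right s hat), smul_zero]
      · obtain ⟨w, hw⟩ := gen_mul_eMon_of_notMem R n (a := a) (s := s ∪ t)
          (by simp only [Finset.mem_union, not_or]
              exact ⟨fun h' => lt_irrefl a (ha a h'), hat⟩)
        exact Or.inr ⟨⟨hat, hd⟩, u * w, by rw [hw, Finset.insert_union, mul_smul]⟩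

lemma exists_eMon_eq_smul_gen_mul {a : Fin n} {s : Finset (Fin n)} (ha : a ∈ s) :
    ∃ u : ℤˣ, eMon R n s = u • (gen R n a * eMon R n (s.erase a)) := by
  obtain ⟨u, hu⟩ := gen_mul_eMon_of_notMem R n (Finset.notMem_erase a s)
  refine ⟨u⁻¹, ?_⟩
  rw [hu, Finset.insert_erase ha, inv_smul_smul]

lemma bdry_insert_of_forall_lt {a : Fin n} {s : Finset (Fin n)} (h : ∀ x ∈ s, a < x) :
    bdry R n (insert a s) = eMon R n s - gen R n a * bdry R n s := by
  have has : a ∉ s := fun ha => lt_irrefl a (h a ha)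
  rw [bdry, Finset.sum_insert has, Finset.erase_insert has, sub_eq_add_neg]
  congr 1
  · have : (insert a s).filter (fun j => j < a) = ∅ := by
      ext j
      simp only [Finset.mem_filter, Finset.mem_insert, Finset.notMem_empty, iff_false, not_and,
        not_lt]
      rintro (rfl | hj)
      exacts [le_rfl, (h j hj).le]
    rw [this, Finset.card_empty, pow_zero, one_mul]
  · rw [bdry, Finset.mul_sum, ← Finset.sum_neg_distrib]
    refine Finset.sum_congr rfl fun i hi => ?_
    have hai := h i hi
    rw [Finset.filter_insert, if_pos hai, Finset.card_insert_of_notMem (by simp [has]),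
      Finset.erase_insert_of_ne hai.ne, eMon_insert_of_forall_lt R n
        (fun x hx => h x (Finset.mem_of_mem_erase hx)), pow_succ, mul_neg_one, neg_mul,
      ← mul_assoc, ← mul_assoc,
      ((Commute.neg_one_left (gen R n a)).pow_left _).eq]

lemma bdry_empty : bdry R n ∅ = 0 := by simp [bdry]

lemma map_gen (f : (Fin n → R) →ₗ[R] (Fin n → R)) (a : Fin n) :
    ExteriorAlgebra.map f (gen R n a) = ExteriorAlgebra.ι R (f (Pi.single a 1)) := by
  rw [gen, ExteriorAlgebra.map_apply_ι]

lemma map_eMon_of_map_single_eq (f : (Fin n → R) →ₗ[R] (Fin n → R)) (s : Finset (Fin n))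
    (h : ∀ a ∈ s, f (Pi.single a 1) = Pi.single a 1) :
    ExteriorAlgebra.map f (eMon R n s) = eMon R n s := by
  induction s using Finset.induction_on_min with
  | empty => simp [eMon_empty]
  | insert a s ha ih =>
    rw [eMon_insert_of_forall_lt R n ha, map_mul, ih fun b hb => h b (Finset.mem_insert_of_mem hb),
      map_gen, h a (Finset.mem_insert_self a s), gen]

lemma map_eMon_eq_zero (f : (Fin n → R) →ₗ[R] (Fin n → R)) {s : Finset (Fin n)} {a : Fin n}
    (ha : a ∈ s) (h : f (Pi.single a 1) = 0) : ExteriorAlgebra.map f (eMon R n s) = 0 := by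
  obtain ⟨u, hu⟩ := exists_eMon_eq_smul_gen_mul R n ha
  rw [hu, Units.smul_def, map_zsmul, map_mul, map_gen, h, map_zero, zero_mul, smul_zero]

lemma map_eMon_eq_zero_of_eq (f : (Fin n → R) →ₗ[R] (Fin n → R)) {s : Finset (Fin n)}
    {a b : Fin n} (ha : a ∈ s) (hb : b ∈ s) (hab : a ≠ b)
    (h : f (Pi.single a 1) = f (Pi.single b 1)) : ExteriorAlgebra.map f (eMon R n s) = 0 := by
  obtain ⟨u, hu⟩ := exists_eMon_eq_smul_gen_mul R n ha
  obtain ⟨w, hw⟩ := exists_eMon_eq_smul_gen_mul R n (Finset.mem_erase.2 ⟨hab.symm, hb⟩)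
  rw [hu, hw, Units.smul_def, map_zsmul, Units.smul_def, mul_smul_comm, map_zsmul, map_mul,
    map_mul, map_gen, map_gen, h, ← mul_assoc, ExteriorAlgebra.ι_sq_zero, zero_mul, smul_zero,
    smul_zero]

lemma map_bdry_eq_contractLeft (f : (Fin n → R) →ₗ[R] (Fin n → R))
    (d : Module.Dual R (Fin n → R)) (s : Finset (Fin n))
    (h : ∀ a ∈ s, d (f (Pi.single a 1)) = 1) :
    ExteriorAlgebra.map f (bdry R n s) =
      CliffordAlgebra.contractLeft d (ExteriorAlgebra.map f (eMon R n s)) := by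
  induction s using Finset.induction_on_min with
  | empty =>
    rw [bdry_empty, eMon_empty, map_zero, map_one]
    exact (CliffordAlgebra.contractLeft_one (Q := (0 : QuadraticForm R (Fin n → R))) d).symm
  | insert a s ha ih =>
    rw [bdry_insert_of_forall_lt R n ha, eMon_insert_of_forall_lt R n ha, map_sub, map_mul,
      map_mul, ih fun b hb => h b (Finset.mem_insert_of_mem hb), map_gen]
    refine Eq.trans ?_ (CliffordAlgebra.contractLeft_ι_mul
      (Q := (0 : QuadraticForm R (Fin n → R))) d _ _).symm
    rw [h a (Finset.mem_insert_self a s), one_smul]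

lemma contractLeft_proj_eMon {a : Fin n} {s : Finset (Fin n)} (ha : a ∉ s) :
    CliffordAlgebra.contractLeft (Q := (0 : QuadraticForm R (Fin n → R)))
      (LinearMap.proj a : Module.Dual R (Fin n → R)) (eMon R n s) = 0 := by
  induction s using Finset.induction_on_min with
  | empty =>
    rw [eMon_empty]
    exact CliffordAlgebra.contractLeft_one (Q := (0 : QuadraticForm R (Fin n → R))) _
  | insert b s hb ih =>
    rw [Finset.mem_insert, not_or] at ha
    rw [eMon_insert_of_forall_lt R n hb]
    refine (CliffordAlgebra.contractLeft_ι_mul (Q := (0 : QuadraticForm R (Fin n → R)))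
      (LinearMap.proj a : Module.Dual R (Fin n → R)) _ _).trans ?_
    rw [ih ha.2, mul_zero, sub_zero, LinearMap.proj_apply, Pi.single_eq_of_ne ha.1, zero_smul]

lemma eq_zero_of_smul_eMon_eq_zero (c : R) (s : Finset (Fin n)) (h : c • eMon R n s = 0) :
    c = 0 := by
  induction s using Finset.induction_on_min with
  | empty =>
    rw [eMon_empty, ← Algebra.algebraMap_eq_smul_one] at h
    exact (ExteriorAlgebra.algebraMap_eq_zero_iff _ _).1 h
  | insert a s ha ih =>
    refine ih ?_
    have key := congrArg (CliffordAlgebra.contractLeft (Q := (0 : QuadraticForm R (Fin n → R)))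
      (LinearMap.proj a : Module.Dual R (Fin n → R))) h
    rw [eMon_insert_of_forall_lt R n ha, map_smul, map_zero] at key
    have e := CliffordAlgebra.contractLeft_ι_mul (Q := (0 : QuadraticForm R (Fin n → R)))
      (LinearMap.proj a : Module.Dual R (Fin n → R)) (Pi.single a 1) (eMon R n s)
    rw [contractLeft_proj_eMon R n fun h' => lt_irrefl a (ha a h'), mul_zero, sub_zero,
      LinearMap.proj_apply, Pi.single_eq_same, one_smul] at e
    rwa [show CliffordAlgebra.contractLeft (Q := (0 : QuadraticForm R (Fin n → R)))
      (LinearMap.proj a : Module.Dual R (Fin n → R)) (gen R n a * eMon R n s) = eMon R n s from e]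
      at key

lemma lamGrade_le_span_eMon (q : ℕ) :
    lamGrade R n q ≤ Submodule.span R {x | ∃ s : Finset (Fin n), s.card = q ∧ x = eMon R n s} := by
  induction q with
  | zero =>
    rw [lamGrade, pow_zero, Submodule.one_le]
    exact Submodule.subset_span ⟨∅, rfl, (eMon_empty R n).symm⟩
  | succ q ih =>
    have hι : LinearMap.range (ι R : (Fin n → R) →ₗ[R] ExteriorAlgebra R (Fin n → R)) ≤
        Submodule.span R (Set.range (gen R n)) := by
      rintro _ ⟨v, rfl⟩
      rw [pi_eq_sum_univ' v, map_sum]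
      refine Submodule.sum_mem _ fun i _ => ?_
      rw [map_smul]
      refine Submodule.smul_mem _ _ (Submodule.subset_span ⟨i, ?_⟩)
      rw [gen]
    rw [lamGrade, pow_succ']
    refine (mul_le_mul' hι ih).trans ?_
    rw [Submodule.span_mul_span, Submodule.span_le]
    rintro _ ⟨_, ⟨a, rfl⟩, _, ⟨s, hs, rfl⟩, rfl⟩
    change gen R n a * eMon R n s ∈ _
    by_cases ha : a ∈ s
    · rw [gen_mul_eMon_of_mem R n ha]
      exact Submodule.zero_mem _
    · obtain ⟨u, hu⟩ := gen_mul_eMon_of_notMem R n ha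
      rw [hu, Units.smul_def]
      refine SetLike.mem_coe.2 (zsmul_mem (Submodule.subset_span ?_) _)
      exact ⟨insert a s, by rw [Finset.card_insert_of_notMem ha, hs], rfl⟩

end Monomials

section NoBrokenCircuit

variable {n : ℕ}

lemma IsCct.isCircuit {M : Matroid (Fin n)} {C : Finset (Fin n)} (hC : IsCct n M C) :
    M.IsCircuit ↑C := by
  refine Matroid.isCircuit_iff.2 ⟨hC.1, fun D hD hDC => ?_⟩
  lift D to Finset (Fin n) using D.toFinite
  by_contra hne
  exact hC.2 D (Finset.coe_ssubset.1 (hDC.ssubset_of_ne hne)) hD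

lemma Matroid.IsCircuit.isCct {M : Matroid (Fin n)} {C : Finset (Fin n)}
    (hC : M.IsCircuit ↑C) : IsCct n M C :=
  ⟨hC.dep, fun _ hD hdep =>
    hD.ne (Finset.coe_injective (hC.eq_of_dep_subset hdep (Finset.coe_subset.2 hD.subset)))⟩

/-- A set `S` is *nbc* (contains no broken circuit) iff no element `e` of the ground set is
spanned by the elements of `S` that are larger than `e`. -/
def IsNbc (M : Matroid (Fin n)) (S : Finset (Fin n)) : Prop :=
  ∀ e, e ∉ M.closure ↑(S.filter (e < ·))

open Classical in
/-- The largest `s ∈ S` such that `i` is spanned by the elements of `S` that are at least `s`,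
or `⊥` if there is none. -/
noncomputable def topSpan (M : Matroid (Fin n)) (S : Finset (Fin n)) (i : Fin n) :
    WithBot (Fin n) :=
  (S.filter fun s => i ∈ M.closure ↑(S.filter (s ≤ ·))).max

variable {M : Matroid (Fin n)} {S T C : Finset (Fin n)} {i s : Fin n}

lemma le_topSpan (hs : s ∈ S) (hi : i ∈ M.closure ↑(S.filter (s ≤ ·))) :
    (s : WithBot (Fin n)) ≤ topSpan M S i := by
  classical
  exact Finset.le_max (Finset.mem_filter.2 ⟨hs, hi⟩)

lemma mem_of_topSpan_eq (h : topSpan M S i = s) :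
    s ∈ S ∧ i ∈ M.closure ↑(S.filter (s ≤ ·)) := by
  classical
  exact Finset.mem_filter.1 (Finset.mem_of_max h)

lemma IsNbc.exists_le_topSpan (hS : IsNbc M S) {W : Finset (Fin n)} (hW : W ⊆ S)
    (hi : i ∈ M.closure ↑W) : ∃ s ∈ W, (s : WithBot (Fin n)) ≤ topSpan M S i := by
  rcases W.eq_empty_or_nonempty with rfl | hne
  · exact absurd (M.closure_subset_closure (by simp) hi) (hS i)
  · refine ⟨W.min' hne, W.min'_mem hne, le_topSpan (hW (W.min'_mem hne)) ?_⟩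
    refine M.closure_subset_closure (Finset.coe_subset.2 fun x hx => ?_) hi
    exact Finset.mem_filter.2 ⟨hW hx, W.min'_le x hx⟩

lemma IsNbc.topSpan_of_mem (hM : M.E = Set.univ) (hS : IsNbc M S) (hs : s ∈ S) :
    topSpan M S s = s := by
  refine le_antisymm ?_ (le_topSpan hs ?_)
  · cases h : topSpan M S s with
    | bot => exact bot_le
    | coe t =>
      refine WithBot.coe_le_coe.2 (not_lt.1 fun hst => hS s ?_)
      refine M.closure_subset_closure (Finset.coe_subset.2 fun x hx => ?_) (mem_of_topSpan_eq h).2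
      rw [Finset.mem_filter] at hx ⊢
      exact ⟨hx.1, hst.trans_le hx.2⟩
  · exact M.mem_closure_of_mem (by simp [hs]) (hM ▸ Set.subset_univ _)

lemma IsNbc.exists_topSpan_eq (hS : IsNbc M S) (hC : IsCct n M C) :
    ∃ a ∈ C, ∃ b ∈ C, a ≠ b ∧ topSpan M S a = topSpan M S b ∧
      ∀ c ∈ C, topSpan M S a ≤ topSpan M S c := by
  have hne : C.Nonempty := Finset.coe_nonempty.1 hC.isCircuit.nonempty
  obtain ⟨a, ha, hmin⟩ := C.exists_min_image (topSpan M S) hne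
  by_contra! hcon
  have hlt : ∀ c ∈ C, c ≠ a → topSpan M S a < topSpan M S c := fun c hc hca =>
    (hmin c hc).lt_of_ne fun h => by
      obtain ⟨d, hd, hd'⟩ := hcon a ha c hc hca.symm h
      exact absurd (hmin d hd) (not_le.2 hd')
  obtain ⟨s, hs, hsle⟩ := hS.exists_le_topSpan
    (W := S.filter fun s : Fin n => topSpan M S a < s) (Finset.filter_subset _ _) (i := a) (by
      refine M.closure_subset_closure_of_subset_closure ?_
        (hC.isCircuit.mem_closure_sdiff_singleton_of_mem ha)
      rintro c ⟨hc, hca⟩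
      have hac := hlt c hc hca
      cases h : topSpan M S c with
      | bot => exact absurd (h ▸ hac) not_lt_bot
      | coe t =>
        rw [h] at hac
        refine M.closure_subset_closure (Finset.coe_subset.2 fun x hx => ?_)
          (mem_of_topSpan_eq h).2
        rw [Finset.mem_filter] at hx ⊢
        exact ⟨hx.1, hac.trans_le (WithBot.coe_le_coe.2 hx.2)⟩)
  exact absurd hsle (not_le.2 (Finset.mem_filter.1 hs).2)

lemma IsNbc.eq_of_injOn_topSpan (hS : IsNbc M S) (hT : IsNbc M T)
    (hcard : T.card = S.card) (hbot : ∀ t ∈ T, topSpan M S t ≠ ⊥)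
    (hinj : Set.InjOn (topSpan M S) T) : T = S := by
  classical
  have himg : T.image (topSpan M S) = S.image (WithBot.some : Fin n → WithBot (Fin n)) := by
    refine Finset.eq_of_subset_of_card_le ?_ ?_
    · intro x hx
      obtain ⟨t, ht, rfl⟩ := Finset.mem_image.1 hx
      obtain ⟨s, hs⟩ := WithBot.ne_bot_iff_exists.1 (hbot t ht)
      exact Finset.mem_image.2 ⟨s, (mem_of_topSpan_eq hs.symm).1, hs⟩
    · rw [Finset.card_image_of_injOn hinj, hcard]
      exact Finset.card_image_le
  have key : ∀ s, s ∈ S → s ∈ T := by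
    intro s
    induction s using WellFoundedGT.induction with
    | ind s ih =>
      intro hs
      obtain ⟨t, ht, hts⟩ := Finset.mem_image.1
        (himg ▸ Finset.mem_image_of_mem WithBot.some hs)
      have hmem := (mem_of_topSpan_eq hts).2
      have hins : (↑(S.filter (s ≤ ·)) : Set (Fin n)) = insert s ↑(S.filter (s < ·)) := by
        ext x
        simp only [Finset.coe_filter, Set.mem_ofPred_eq, Set.mem_insert_iff]
        grind
      have hnot : t ∉ M.closure ↑(S.filter (s < ·)) := fun h => by
        obtain ⟨s', hs', hle⟩ := hS.exists_le_topSpan (Finset.filter_subset _ _) h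
        rw [hts, WithBot.coe_le_coe] at hle
        exact absurd hle (not_le.2 (Finset.mem_filter.1 hs').2)
      have hst : s ≤ t := by
        by_contra! hlt
        refine hS t (M.closure_subset_closure (Finset.coe_subset.2 fun x hx => ?_) hmem)
        rw [Finset.mem_filter] at hx ⊢
        exact ⟨hx.1, hlt.trans_le hx.2⟩
      rcases hst.eq_or_lt with rfl | hlt
      · exact ht
      · rw [hins] at hmem
        refine absurd (M.closure_subset_closure ?_ (Matroid.mem_closure_insert hnot hmem)) (hT s)
        rintro x (rfl | hx)
        · exact Finset.mem_coe.2 (Finset.mem_filter.2 ⟨ht, hlt⟩)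
        · have hx' := Finset.mem_filter.1 (Finset.mem_coe.1 hx)
          exact Finset.mem_coe.2 (Finset.mem_filter.2 ⟨ih x hx'.2 hx'.1, hx'.2⟩)
  exact (Finset.eq_of_subset_of_card_le key hcard.le).symm

lemma exists_isCct_of_not_isNbc (hS : ¬ IsNbc M S) :
    ∃ e C, IsCct n M C ∧ e ∈ C ∧ C.erase e ⊆ S ∧ ∀ c ∈ C.erase e, e < c := by
  simp only [IsNbc, not_forall, not_not] at hS
  obtain ⟨e, he⟩ := hS
  obtain ⟨C, hCS, hC, heC⟩ := Matroid.exists_isCircuit_of_mem_closure he (by simp)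
  lift C to Finset (Fin n) using C.toFinite
  have h : ∀ c ∈ C.erase e, c ∈ S.filter (e < ·) := fun c hc =>
    Finset.mem_coe.1 ((hCS (Finset.mem_of_mem_erase hc)).resolve_left (Finset.ne_of_mem_erase hc))
  exact ⟨e, C, hC.isCct, heC, fun c hc => (Finset.mem_filter.1 (h c hc)).1,
    fun c hc => (Finset.mem_filter.1 (h c hc)).2⟩

end NoBrokenCircuit

section OrlikSolomon

variable {n}

/-- The linear map sending the basis vector at `i` to the one at `topSpan M S i`, or to zero
if `i` is not spanned by `S`. -/
noncomputable def topSpanMap (M : Matroid (Fin n)) (S : Finset (Fin n)) :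
    (Fin n → R) →ₗ[R] (Fin n → R) :=
  (Pi.basisFun R (Fin n)).constr R fun i =>
    (topSpan M S i).recBotCoe (C := fun _ => Fin n → R) 0 fun s => Pi.single s 1

variable {M : Matroid (Fin n)} {S T : Finset (Fin n)}

lemma topSpanMap_single (M : Matroid (Fin n)) (S : Finset (Fin n)) (i : Fin n) :
    topSpanMap R M S (Pi.single i 1) =
      (topSpan M S i).recBotCoe (C := fun _ => Fin n → R) 0 fun s => Pi.single s 1 := by
  rw [topSpanMap, ← Pi.basisFun_apply, Module.Basis.constr_basis]

lemma IsNbc.map_bdry_eq_zero (hS : IsNbc M S) {C : Finset (Fin n)} (hC : IsCct n M C) :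
    ExteriorAlgebra.map (topSpanMap R M S) (bdry R n C) = 0 := by
  obtain ⟨a, ha, b, hb, hab, heq, hmin⟩ := hS.exists_topSpan_eq hC
  by_cases hbot : topSpan M S a = ⊥
  · have h0 : ∀ c, topSpan M S c = ⊥ → topSpanMap R M S (Pi.single c 1) = 0 := fun c hc => by
      rw [topSpanMap_single, hc, WithBot.recBotCoe_bot]
    rw [bdry, map_sum]
    refine Finset.sum_eq_zero fun i _ => ?_
    rw [map_mul]
    by_cases hia : a = i
    · subst hia
      rw [map_eMon_eq_zero R n _ (Finset.mem_erase.2 ⟨hab.symm, hb⟩) (h0 b (heq ▸ hbot)), mul_zero]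
    · rw [map_eMon_eq_zero R n _ (Finset.mem_erase.2 ⟨hia, ha⟩) (h0 a hbot), mul_zero]
  · rw [map_bdry_eq_contractLeft R n (topSpanMap R M S) (∑ i, LinearMap.proj i) C,
      map_eMon_eq_zero_of_eq R n _ ha hb hab, map_zero]
    · rw [topSpanMap_single, topSpanMap_single, heq]
    · intro c hc
      have hcb : topSpan M S c ≠ ⊥ := fun h => hbot (le_bot_iff.1 (h ▸ hmin c hc))
      obtain ⟨s, hs⟩ := WithBot.ne_bot_iff_exists.1 hcb
      rw [topSpanMap_single, ← hs, WithBot.recBotCoe_coe]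
      simp [LinearMap.sum_apply]

lemma IsNbc.osIdeal_le_ker (hS : IsNbc M S) :
    osIdeal R n (circuits n M) ≤
      LinearMap.ker (ExteriorAlgebra.map (topSpanMap R M S)).toLinearMap := by
  rw [osIdeal, Submodule.span_le]
  rintro _ ⟨a, b, C, hC, rfl⟩
  simp [hS.map_bdry_eq_zero R hC]

lemma IsNbc.map_eMon_self (hM : M.E = Set.univ) (hS : IsNbc M S) :
    ExteriorAlgebra.map (topSpanMap R M S) (eMon R n S) = eMon R n S :=
  map_eMon_of_map_single_eq R n _ S fun s hs => by
    rw [topSpanMap_single, hS.topSpan_of_mem hM hs, WithBot.recBotCoe_coe]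

lemma IsNbc.map_eMon_eq_zero_of_ne (hS : IsNbc M S) (hT : IsNbc M T)
    (hcard : T.card = S.card) (hne : T ≠ S) :
    ExteriorAlgebra.map (topSpanMap R M S) (eMon R n T) = 0 := by
  by_contra h
  refine hne (hS.eq_of_injOn_topSpan hT hcard (fun t ht hbot => h ?_) fun a ha b hb hab => ?_)
  · exact map_eMon_eq_zero R n _ ht (by rw [topSpanMap_single, hbot, WithBot.recBotCoe_bot])
  · by_contra hne'
    exact h (map_eMon_eq_zero_of_eq R n _ ha hb hne'
      (by rw [topSpanMap_single, topSpanMap_single, hab]))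

lemma bdry_mul_mem_osIdeal {C : Finset (Fin n)} (hC : IsCct n M C)
    (b : ExteriorAlgebra R (Fin n → R)) : bdry R n C * b ∈ osIdeal R n (circuits n M) :=
  Submodule.subset_span ⟨1, b, C, hC, by rw [one_mul]⟩

lemma neg_one_pow_mul_mem_iff {N : Submodule R (ExteriorAlgebra R (Fin n → R))} (k : ℕ)
    {x : ExteriorAlgebra R (Fin n → R)} : (-1) ^ k * x ∈ N ↔ x ∈ N := by
  rcases neg_one_pow_eq_or (ExteriorAlgebra R (Fin n → R)) k with h | h <;> simp [h]

lemma units_int_smul_mem_iff {N : Submodule R (ExteriorAlgebra R (Fin n → R))} (u : ℤˣ)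
    {x : ExteriorAlgebra R (Fin n → R)} : u • x ∈ N ↔ x ∈ N := by
  rcases Int.units_eq_one_or u with rfl | rfl <;> simp [Units.smul_def]

lemma eMon_mem_span_isNbc_sup_osIdeal (X : Finset (Fin n)) :
    eMon R n X ∈ Submodule.span R {x | ∃ T, IsNbc M T ∧ T.card = X.card ∧ x = eMon R n T} ⊔
      osIdeal R n (circuits n M) := by
  induction hk : ∑ x ∈ X, (x : ℕ) using Nat.strong_induction_on generalizing X with
  | _ k ih =>
    subst hk
    by_cases hX : IsNbc M X
    · exact Submodule.mem_sup_left (Submodule.subset_span ⟨X, hX, rfl, rfl⟩)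
    obtain ⟨e, C, hC, heC, hCX, hlt⟩ := exists_isCct_of_not_isNbc hX
    set N := Submodule.span R {x | ∃ T, IsNbc M T ∧ T.card = X.card ∧ x = eMon R n T} ⊔
      osIdeal R n (circuits n M)
    have hmem : bdry R n C * eMon R n (X \ C.erase e) ∈ N :=
      Submodule.mem_sup_right (bdry_mul_mem_osIdeal R hC _)
    rw [bdry, Finset.sum_mul, ← Finset.add_sum_erase _ _ heC] at hmem
    have hrest : ∑ c ∈ C.erase e, (-1) ^ (C.filter (· < c)).card * eMon R n (C.erase c) *
        eMon R n (X \ C.erase e) ∈ N := by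
      refine Submodule.sum_mem _ fun c hc => ?_
      rw [mul_assoc, neg_one_pow_mul_mem_iff]
      rcases eMon_mul_eMon R n (C.erase c) (X \ C.erase e) with ⟨-, h⟩ | ⟨hd, u, h⟩
      · rw [h]
        exact Submodule.zero_mem _
      rw [h, units_int_smul_mem_iff]
      have hec : e < c := hlt c hc
      have heX : e ∉ X := fun heX => Finset.disjoint_left.1 hd
        (Finset.mem_erase.2 ⟨hec.ne, heC⟩) (by simp [heX])
      have hunion : C.erase c ∪ X \ C.erase e = insert e (X.erase c) := by
        ext x
        have hx : x ∈ C.erase e → x ∈ X := fun hx => hCX hx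
        simp only [Finset.mem_union, Finset.mem_erase, Finset.mem_sdiff, Finset.mem_insert]
          at hx hc ⊢
        grind
      have heX' : e ∉ X.erase c := fun h' => heX (Finset.mem_of_mem_erase h')
      have hcX : c ∈ X := hCX hc
      have hcard : (insert e (X.erase c)).card = X.card := by
        rw [Finset.card_insert_of_notMem heX', Finset.card_erase_add_one hcX]
      rw [hunion]
      have := ih _ ?_ (insert e (X.erase c)) rfl
      · rwa [hcard] at this
      · rw [Finset.sum_insert heX', ← Finset.add_sum_erase _ _ hcX]
        exact Nat.add_lt_add_right hec _
    have hfirst := (Submodule.add_mem_iff_left _ hrest).1 hmem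
    rw [mul_assoc, neg_one_pow_mul_mem_iff] at hfirst
    rcases eMon_mul_eMon R n (C.erase e) (X \ C.erase e) with ⟨hd, -⟩ | ⟨-, u, h⟩
    · exact absurd Finset.disjoint_sdiff hd
    · rwa [h, units_int_smul_mem_iff, Finset.union_sdiff_of_subset hCX] at hfirst

lemma lamGrade_le_span_isNbc_sup_osIdeal (M : Matroid (Fin n)) (q : ℕ) :
    lamGrade R n q ≤ Submodule.span R {x | ∃ T, IsNbc M T ∧ T.card = q ∧ x = eMon R n T} ⊔
      osIdeal R n (circuits n M) := by
  refine (lamGrade_le_span_eMon R n q).trans (Submodule.span_le.2 ?_)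
  rintro _ ⟨X, rfl, rfl⟩
  exact eMon_mem_span_isNbc_sup_osIdeal R X

/-- A combination of nbc monomials of a fixed degree with a nonzero multiple in the Orlik–Solomon
ideal vanishes. -/
lemma eq_zero_of_smul_mem_osIdeal [NoZeroDivisors R] (hM : M.E = Set.univ) (q : ℕ) {m : R}
    (hm : m ≠ 0) {y : ExteriorAlgebra R (Fin n → R)}
    (hy : y ∈ Submodule.span R {x | ∃ T, IsNbc M T ∧ T.card = q ∧ x = eMon R n T})
    (hmy : m • y ∈ osIdeal R n (circuits n M)) : y = 0 := by
  classical
  have hset : {x | ∃ T, IsNbc M T ∧ T.card = q ∧ x = eMon R n T} =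
      eMon R n '' ↑(Finset.univ.filter fun T : Finset (Fin n) => IsNbc M T ∧ T.card = q) := by
    ext x
    simp [and_assoc, eq_comm]
  rw [hset, Submodule.mem_span_image_finset_iff_exists_fun'] at hy
  obtain ⟨c, rfl⟩ := hy
  refine Finset.sum_eq_zero fun S hS => ?_
  obtain ⟨-, hSn, hSq⟩ := Finset.mem_filter.1 hS
  have h := hSn.osIdeal_le_ker R hmy
  rw [LinearMap.mem_ker, map_smul, map_sum, Finset.sum_eq_single_of_mem S hS] at h
  · rw [map_smul, AlgHom.toLinearMap_apply, hSn.map_eMon_self R hM, smul_smul] at h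
    have h0 := eq_zero_of_smul_eMon_eq_zero R n _ _ h
    rw [(mul_eq_zero.1 h0).resolve_left hm, zero_smul]
  · intro T hT hTS
    obtain ⟨-, hTn, hTq⟩ := Finset.mem_filter.1 hT
    rw [map_smul, AlgHom.toLinearMap_apply,
      hSn.map_eMon_eq_zero_of_ne R hTn (hTq.trans hSq.symm) hTS, smul_zero]

lemma mem_osIdeal_of_smul_mem [NoZeroDivisors R] (hM : M.E = Set.univ) {q : ℕ} {m : R}
    (hm : m ≠ 0) {x : ExteriorAlgebra R (Fin n → R)} (hx : x ∈ lamGrade R n q)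
    (hmx : m • x ∈ osIdeal R n (circuits n M)) : x ∈ osIdeal R n (circuits n M) := by
  obtain ⟨y, hy, z, hz, rfl⟩ :=
    Submodule.mem_sup.1 (lamGrade_le_span_isNbc_sup_osIdeal R M q hx)
  rw [smul_add, Submodule.add_mem_iff_left _ (Submodule.smul_mem _ _ hz)] at hmx
  rwa [eq_zero_of_smul_mem_osIdeal R hM q hm hy hmx, zero_add]

end OrlikSolomon

/-- The Orlik–Solomon algebra `A(M) = Λ/I(M)` over `ℤ` of a simple matroid
on `[n]` is torsion free in every degree `q`. -/
theorem stmt_11 (n : ℕ) (hn : 1 ≤ n) (M : Matroid (Fin n)) (hsimple : IsSimple n M) (q : ℕ)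
    (m : ℤ) (hm : m ≠ 0)
    (x : ↥(lamGrade ℤ n q) ⧸
      Submodule.comap (lamGrade ℤ n q).subtype (osIdeal ℤ n (circuits n M)))
    (hx : m • x = 0) : x = 0 := by
  obtain ⟨x, rfl⟩ := Submodule.Quotient.mk_surjective _ x
  rw [← Submodule.Quotient.mk_smul, Submodule.Quotient.mk_eq_zero, Submodule.mem_comap] at hx
  rw [Submodule.Quotient.mk_eq_zero, Submodule.mem_comap]
  exact mem_osIdeal_of_smul_mem ℤ hsimple.1 hm x.2 hx
end

section
/- Let M be the matroid on the six-element ground set {x, y, z, t, H, P} whose circuits are exactly {H,P,y,z}, {H,P,x,t}, {H,x,y,z,t}, {P,x,y,z,t}, and let K be a field. With respect to a monomial order ≺ on Λ_K whose restriction to generators is e_H ≺ e_P ≺ e_x ≺ e_y ≺ e_z ≺ e_t, the set { ∂(e_{{H,P,y,z}}), ∂(e_{{H,P,x,t}}), ∂(e_{{H,x,y,z,t}}) } is a reduced Gröbner basis of the Orlik–Solomon ideal I(M)_K, whereas with respect to a monomial order whose restriction to generators is e_x ≺ e_y ≺ e_z ≺ e_t ≺ e_H ≺ e_P, the set { ∂(e_{{y,z,H,P}}),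 ∂(e_{{x,t,H,P}}), ∂(e_{{x,y,z,t,H}}), ∂(e_{{x,y,z,t,P}}) } is a reduced Gröbner basis of I(M)_K. -/
/-- A monomial order on the exterior algebra `Λ_K` on `n` generators, realized as a strict
total order on the monomials `e_X` (identified with their index sets `X ⊆ [n]`), such that
`1 = e_∅` is smallest and the order is compatible with multiplication: note that
`e_X ∧ e_Z ≠ 0` iff `X` and `Z` are disjoint, in which case the underlying monomial of
`e_X ∧ e_Z` is `e_{X ∪ Z}`. -/
structure MonOrder (n : ℕ) where
  lt : Finset (Fin n) → Finset (Fin n) → Prop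
  irrefl : ∀ X, ¬ lt X X
  trans : ∀ X Y Z, lt X Y → lt Y Z → lt X Z
  total : ∀ X Y, X ≠ Y → lt X Y ∨ lt Y X
  one_lt : ∀ X, X ≠ ∅ → lt ∅ X
  mul_compat : ∀ X Y Z, lt X Y → Disjoint X Z → Disjoint Y Z → lt (X ∪ Z) (Y ∪ Z)

variable (K : Type*) [Field K] (n : ℕ)

/-- The exterior algebra `Λ_K` on `n` generators as a `K`-vector space: an element is the
finitely supported family of its coordinates in the monomial basis `{e_X : X ⊆ [n]}`. -/
abbrev ExtF (K : Type*) [Field K] (n : ℕ) := Finset (Fin n) →₀ K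

/-- `∂(e_X) = Σ_k (−1)^{k−1} e_{X \ {i_k}}`, in monomial coordinates. -/
noncomputable def bdryF (X : Finset (Fin n)) : ExtF K n :=
  ∑ i ∈ X, ((-1 : K) ^ (X.filter (fun j => j < i)).card) •
    Finsupp.single (X.erase i) (1 : K)

/-- `X` is the initial monomial `in_≺(f)`: the `≺`-largest monomial in the support of `f`. -/
def IsInitial (ord : MonOrder n) (f : ExtF K n) (X : Finset (Fin n)) : Prop :=
  X ∈ f.support ∧ ∀ Y ∈ f.support, Y ≠ X → ord.lt Y X

/-- The Koszul-type sign `ε(S, Y)` with `e_S ∧ e_Y = ε(S, Y) e_{S ∪ Y}` for disjoint `S, Y`. -/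
def sgn (S Y : Finset (Fin n)) : K :=
  (-1 : K) ^ ((S ×ˢ Y).filter (fun p => p.2 < p.1)).card

/-- Left multiplication by the monomial `e_S`. -/
noncomputable def mulMon (S : Finset (Fin n)) (f : ExtF K n) : ExtF K n :=
  f.sum fun Y c =>
    if Disjoint S Y then (sgn K n S Y * c) • Finsupp.single (S ∪ Y) (1 : K) else 0

/-- The Orlik–Solomon ideal `I(M)_K`: the (two-sided) ideal generated by the boundaries
`∂(e_C)` of circuits; since each `∂(e_C)` is homogeneous, it is the span of the monomial
multiples `e_S ∂(e_C)`. -/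
noncomputable def idealF (cs : Set (Finset (Fin n))) : Submodule K (ExtF K n) :=
  Submodule.span K {f | ∃ S : Finset (Fin n), ∃ C ∈ cs, f = mulMon K n S (bdryF K n C)}

/-- The decomposable Orlik–Solomon ideal `Λ⁺I(M)_K`: the span of the monomial multiples
`e_S ∂(e_C)` with `e_S` of strictly positive degree. -/
noncomputable def decIdealF (cs : Set (Finset (Fin n))) : Submodule K (ExtF K n) :=
  Submodule.span K
    {f | ∃ S : Finset (Fin n), S ≠ ∅ ∧ ∃ C ∈ cs, f = mulMon K n S (bdryF K n C)}

/-- The degree-`q` graded component `Λ^q_K`: the span of the monomials `e_X` with `|X| = q`. -/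
def gradeF (q : ℕ) : Submodule K (ExtF K n) where
  carrier := {f | ∀ X ∈ f.support, X.card = q}
  add_mem' := by
    intro f g hf hg X hX
    rcases Finset.mem_union.mp (Finsupp.support_add hX) with h | h
    · exact hf X h
    · exact hg X h
  zero_mem' := by intro X hX; simp at hX
  smul_mem' := by
    intro c f hf X hX
    exact hf X (Finsupp.support_smul hX)

/-- `G` is a reduced Gröbner basis of the ideal `I` with respect to the monomial order
`ord`: `G` is a finite subset of `I` such that the initial monomial of every nonzero `f ∈ I`
is divisible by the initial monomial of some `g ∈ G` (`e_X` divides `e_Y` iff `X ⊆ Y`);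
every `g ∈ G` has leading coefficient `1`; and for `g ≠ g'` in `G`, no monomial in the
support of `g'` is divisible by the initial monomial of `g`. -/
def IsRedGB (ord : MonOrder n) (G : Set (ExtF K n)) (I : Submodule K (ExtF K n)) : Prop :=
  G.Finite ∧ G ⊆ (I : Set (ExtF K n)) ∧
  (∀ f ∈ I, f ≠ 0 → ∃ g ∈ G, ∀ X Y,
    IsInitial K n ord f X → IsInitial K n ord g Y → Y ⊆ X) ∧
  (∀ g ∈ G, ∀ Y, IsInitial K n ord g Y → g Y = 1) ∧
  (∀ g ∈ G, ∀ g' ∈ G, g ≠ g' → ∀ Y, IsInitial K n ord g Y → ∀ X ∈ g'.support, ¬ Y ⊆ X)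

/-- The circuits of the matroid of the arrangement `xyzt(x+y+z+t)(x−y−z+t) = 0` in `ℂ⁴`,
on the six-element ground set `{x, y, z, t, H, P}` identified with `Fin 6` via
`x = 0, y = 1, z = 2, t = 3, H = 4, P = 5`: the circuits are
`{H,P,y,z}, {H,P,x,t}, {H,x,y,z,t}, {P,x,y,z,t}`. -/
def exCircuits : Set (Finset (Fin 6)) :=
  {({4, 5, 1, 2} : Finset (Fin 6)), ({4, 5, 0, 3} : Finset (Fin 6)),
   ({4, 0, 1, 2, 3} : Finset (Fin 6)), ({5, 0, 1, 2, 3} : Finset (Fin 6))}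

section NormalForm

variable {K n}

/-- The coefficient of `e_{S ∪ C \ {i}}` in the term of `e_S ∧ ∂(e_C)` that omits `i`. -/
def mulBdryCoeff (S C : Finset (Fin n)) (i : Fin n) : ℤ :=
  if Disjoint S (C.erase i) then
    (-1) ^ ((S ×ˢ C.erase i).filter (fun p => p.2 < p.1)).card *
      (-1) ^ (C.filter (fun j => j < i)).card
  else 0

theorem disjoint_of_mulBdryCoeff_ne_zero {S C : Finset (Fin n)} {i : Fin n}
    (h : mulBdryCoeff S C i ≠ 0) : Disjoint S (C.erase i) := by
  by_contra hd
  simp [mulBdryCoeff, hd] at h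

/-- The coefficient of `e_X` in the remainder of `e_Y` after at most `k` rounds of reduction
modulo the elements `∂(e_C)` with leading monomials `e_{C \ {m}}`, for `(C, m) ∈ R`. -/
def remCoeff (R : List (Finset (Fin n) × Fin n)) :
    ℕ → Finset (Fin n) → Finset (Fin n) → ℤ
  | 0, X, Y => if Y = X then 1 else 0
  | k + 1, X, Y =>
    match R.find? (fun p => p.1.erase p.2 ⊆ Y) with
    | none => if Y = X then 1 else 0
    | some p =>
      -mulBdryCoeff (Y \ p.1.erase p.2) p.1 p.2 *
        ∑ i ∈ p.1.erase p.2, mulBdryCoeff (Y \ p.1.erase p.2) p.1 i *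
          remCoeff R k X ((Y \ p.1.erase p.2) ∪ p.1.erase i)

theorem remCoeff_self {R : List (Finset (Fin n) × Fin n)} {X : Finset (Fin n)}
    (hX : ∀ p ∈ R, ¬ p.1.erase p.2 ⊆ X) (k : ℕ) : remCoeff R k X X = 1 := by
  cases k with
  | zero => simp [remCoeff]
  | succ k =>
    have h : R.find? (fun p => p.1.erase p.2 ⊆ X) = none := by
      simpa [List.find?_eq_none] using hX
    simp [remCoeff, h]

namespace MonOrder

variable (ord : MonOrder n)

theorem lt_union_erase {S C : Finset (Fin n)} {m i : Fin n} (hm : m ∈ C) (hi : i ∈ C)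
    (hlt : ord.lt {m} {i}) (hmS : m ∉ S) (hiS : i ∉ S) :
    ord.lt (S ∪ C.erase i) (S ∪ C.erase m) := by
  have hne : m ≠ i := by
    rintro rfl
    exact ord.irrefl _ hlt
  have h := ord.mul_compat {m} {i} (S ∪ (C.erase i).erase m) hlt (by simp [hmS])
    (by simp [hiS])
  convert h using 1
  · ext a
    by_cases ha : a = m <;> simp_all
  · ext a
    by_cases ha : a = i
    · subst ha
      simp [hi, hne.symm]
    · simp [ha]

theorem eq_or_lt_of_remCoeff_ne_zero {R : List (Finset (Fin n) × Fin n)}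
    (hR : ∀ p ∈ R, p.2 ∈ p.1 ∧ ∀ i ∈ p.1, i ≠ p.2 → ord.lt {p.2} {i}) (k : ℕ)
    {X Y : Finset (Fin n)} (h : remCoeff R k X Y ≠ 0) : Y = X ∨ ord.lt X Y := by
  induction k generalizing Y with
  | zero =>
    left
    by_contra hne
    simp [remCoeff, hne] at h
  | succ k ih =>
    rw [remCoeff] at h
    split at h
    · left
      by_contra hne
      simp [hne] at h
    · rename_i p hp
      right
      have hsub : p.1.erase p.2 ⊆ Y := by simpa using List.find?_some hp
      obtain ⟨hm, hlt⟩ := hR p (List.mem_of_find?_eq_some hp)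
      obtain ⟨i, hi, hne⟩ := Finset.exists_ne_zero_of_sum_ne_zero (right_ne_zero_of_mul h)
      obtain ⟨him, hiC⟩ := Finset.mem_erase.mp hi
      have hdisj : Disjoint (Y \ p.1.erase p.2) (p.1.erase i) :=
        disjoint_of_mulBdryCoeff_ne_zero (left_ne_zero_of_mul hne)
      have hmS : p.2 ∉ Y \ p.1.erase p.2 :=
        Finset.disjoint_right.mp hdisj (Finset.mem_erase.mpr ⟨him.symm, hm⟩)
      have key := ord.lt_union_erase hm hiC (hlt i hiC him) hmS (by simp [hi])
      rw [Finset.sdiff_union_of_subset hsub] at key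
      rcases ih (right_ne_zero_of_mul hne) with heq | hlt'
      · exact heq ▸ key
      · exact ord.trans _ _ _ hlt' key

end MonOrder

theorem IsInitial.unique {ord : MonOrder n} {f : ExtF K n} {X Y : Finset (Fin n)}
    (hX : IsInitial K n ord f X) (hY : IsInitial K n ord f Y) : X = Y := by
  by_contra hne
  exact ord.irrefl X (ord.trans _ _ _ (hY.2 X hX.1 hne) (hX.2 Y hY.1 (Ne.symm hne)))

theorem mulMon_bdryF (S C : Finset (Fin n)) :
    mulMon K n S (bdryF K n C) =
      ∑ i ∈ C, (mulBdryCoeff S C i : K) • Finsupp.single (S ∪ C.erase i) (1 : K) := by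
  have hlin : ∀ f : ExtF K n, mulMon K n S f = Finsupp.linearCombination K
      (fun Y => if Disjoint S Y then sgn K n S Y • Finsupp.single (S ∪ Y) (1 : K) else 0) f := by
    intro f
    rw [mulMon, Finsupp.linearCombination_apply]
    refine Finsupp.sum_congr fun Y _ => ?_
    split_ifs
    · rw [smul_smul, mul_comm]
    · simp
  rw [hlin, bdryF, map_sum]
  refine Finset.sum_congr rfl fun i _ => ?_
  rw [map_smul, Finsupp.linearCombination_single, one_smul, mulBdryCoeff]
  split_ifs
  · rw [smul_smul, mul_comm]
    simp [sgn]
  · simp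

theorem mulMon_empty_bdryF (C : Finset (Fin n)) :
    mulMon K n ∅ (bdryF K n C) = bdryF K n C := by
  rw [mulMon_bdryF, bdryF]
  simp [mulBdryCoeff]

theorem bdryF_apply_erase {C : Finset (Fin n)} {i : Fin n} (hi : i ∈ C) :
    bdryF K n C (C.erase i) = (-1 : K) ^ (C.filter (fun j => j < i)).card := by
  rw [bdryF, Finsupp.finsetSum_apply, Finset.sum_eq_single i]
  · simp
  · intro j hj hji
    have : C.erase j ≠ C.erase i := fun h => hji (Finset.erase_injOn C hj hi h)
    simp [this]
  · exact fun h => absurd hi h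

theorem exists_erase_of_mem_support_bdryF {C Y : Finset (Fin n)}
    (hY : Y ∈ (bdryF K n C).support) : ∃ i ∈ C, C.erase i = Y := by
  rw [Finsupp.mem_support_iff, bdryF, Finsupp.finsetSum_apply] at hY
  obtain ⟨i, hi, hne⟩ := Finset.exists_ne_zero_of_sum_ne_zero hY
  refine ⟨i, hi, ?_⟩
  by_contra h
  simp [h] at hne

theorem isInitial_bdryF (ord : MonOrder n) {C : Finset (Fin n)} {m : Fin n} (hm : m ∈ C)
    (hlt : ∀ i ∈ C, i ≠ m → ord.lt {m} {i}) :
    IsInitial K n ord (bdryF K n C) (C.erase m) := by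
  refine ⟨by simp [bdryF_apply_erase hm], fun Y hY hne => ?_⟩
  obtain ⟨i, hi, rfl⟩ := exists_erase_of_mem_support_bdryF hY
  have him : i ≠ m := fun h => hne (h ▸ rfl)
  simpa using ord.lt_union_erase (S := ∅) hm hi (hlt i hi him) (by simp) (by simp)

theorem card_union_erase {S C : Finset (Fin n)} {i : Fin n} (hi : i ∈ C)
    (hd : Disjoint S (C.erase i)) : (S ∪ C.erase i).card + 1 = S.card + C.card := by
  rw [Finset.card_union_of_disjoint hd, add_assoc, Finset.card_erase_add_one hi]

theorem card_eq_of_remCoeff_ne_zero {R : List (Finset (Fin n) × Fin n)}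
    (hR : ∀ p ∈ R, p.2 ∈ p.1) (k : ℕ) {X Y : Finset (Fin n)} (h : remCoeff R k X Y ≠ 0) :
    Y.card = X.card := by
  induction k generalizing Y with
  | zero =>
    by_contra hne
    have : Y ≠ X := fun h => hne (h ▸ rfl)
    simp [remCoeff, this] at h
  | succ k ih =>
    rw [remCoeff] at h
    split at h
    · by_contra hne
      have : Y ≠ X := fun h => hne (h ▸ rfl)
      simp [this] at h
    · rename_i p hp
      have hsub : p.1.erase p.2 ⊆ Y := by simpa using List.find?_some hp
      have hm := hR p (List.mem_of_find?_eq_some hp)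
      obtain ⟨i, hi, hne⟩ := Finset.exists_ne_zero_of_sum_ne_zero (right_ne_zero_of_mul h)
      have hi' := card_union_erase (Finset.mem_of_mem_erase hi)
        (disjoint_of_mulBdryCoeff_ne_zero (left_ne_zero_of_mul hne))
      have hm' := card_union_erase hm (Finset.sdiff_disjoint (s := p.1.erase p.2) (t := Y))
      rw [Finset.sdiff_union_of_subset hsub] at hm'
      have := ih (right_ne_zero_of_mul hne)
      omega

theorem exists_erase_subset_of_isInitial (ord : MonOrder n) {cs : Set (Finset (Fin n))}
    {R : List (Finset (Fin n) × Fin n)} (k : ℕ)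
    (hR : ∀ p ∈ R, p.2 ∈ p.1 ∧ ∀ i ∈ p.1, i ≠ p.2 → ord.lt {p.2} {i})
    (hrem : ∀ X, (∀ p ∈ R, ¬ p.1.erase p.2 ⊆ X) → ∀ C ∈ cs, ∀ S,
      S.card + C.card = X.card + 1 →
        ∑ i ∈ C, mulBdryCoeff S C i * remCoeff R k X (S ∪ C.erase i) = 0)
    {f : ExtF K n} (hf : f ∈ idealF K n cs) {X : Finset (Fin n)}
    (hX : IsInitial K n ord f X) : ∃ p ∈ R, p.1.erase p.2 ⊆ X := by
  by_contra! hN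
  have hsum : ∀ S, ∀ C ∈ cs,
      ∑ i ∈ C, mulBdryCoeff S C i * remCoeff R k X (S ∪ C.erase i) = 0 := by
    intro S C hC
    by_cases hcard : S.card + C.card = X.card + 1
    · exact hrem X hN C hC S hcard
    · refine Finset.sum_eq_zero fun i hi => ?_
      by_contra hne
      have h₁ := card_union_erase hi (disjoint_of_mulBdryCoeff_ne_zero (left_ne_zero_of_mul hne))
      have h₂ := card_eq_of_remCoeff_ne_zero (fun p hp => (hR p hp).1) k
        (right_ne_zero_of_mul hne)
      omega
  let φ : ExtF K n →ₗ[K] K :=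
    Finsupp.linearCombination K (fun Y => (remCoeff R k X Y : K))
  have hφ : idealF K n cs ≤ LinearMap.ker φ := by
    rw [idealF, Submodule.span_le]
    rintro _ ⟨S, C, hC, rfl⟩
    have h := congrArg (Int.cast : ℤ → K) (hsum S C hC)
    push_cast at h
    simpa [mulMon_bdryF, φ] using h
  have hf0 : φ f = 0 := hφ hf
  rw [Finsupp.linearCombination_apply, Finsupp.sum, Finset.sum_eq_single X] at hf0
  · rw [remCoeff_self hN] at hf0
    exact Finsupp.mem_support_iff.mp hX.1 (by simpa using hf0)
  · intro Y hY hne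
    by_cases h0 : remCoeff R k X Y = 0
    · simp [h0]
    · rcases ord.eq_or_lt_of_remCoeff_ne_zero hR k h0 with h | h
      · exact absurd h hne
      · exact absurd (ord.trans _ _ _ h (hX.2 Y hY hne)) (ord.irrefl X)
  · exact fun h => absurd hX.1 h

theorem isRedGB_bdryF (ord : MonOrder n) {cs : Set (Finset (Fin n))}
    {R : List (Finset (Fin n) × Fin n)} (k : ℕ) (hne : R ≠ []) (hcs : ∀ p ∈ R, p.1 ∈ cs)
    (hR : ∀ p ∈ R, p.2 ∈ p.1 ∧ ∀ i ∈ p.1, i ≠ p.2 → ord.lt {p.2} {i})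
    (hrem : ∀ X, (∀ p ∈ R, ¬ p.1.erase p.2 ⊆ X) → ∀ C ∈ cs, ∀ S,
      S.card + C.card = X.card + 1 →
        ∑ i ∈ C, mulBdryCoeff S C i * remCoeff R k X (S ∪ C.erase i) = 0)
    (heven : ∀ p ∈ R, Even (p.1.filter (fun j => j < p.2)).card)
    (hred : ∀ p ∈ R, ∀ q ∈ R, p ≠ q → ∀ i ∈ q.1, ¬ p.1.erase p.2 ⊆ q.1.erase i) :
    IsRedGB K n ord {g | ∃ p ∈ R, bdryF K n p.1 = g} (idealF K n cs) := by
  have hin : ∀ p ∈ R, IsInitial K n ord (bdryF K n p.1) (p.1.erase p.2) := fun p hp =>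
    isInitial_bdryF ord (hR p hp).1 (hR p hp).2
  have hfin : {g | ∃ p ∈ R, bdryF K n p.1 = g}.Finite := by
    have := (List.finite_toSet R).image (fun p => bdryF K n p.1)
    exact this
  refine ⟨hfin, ?_, ?_, ?_, ?_⟩
  · rintro _ ⟨p, hp, rfl⟩
    exact Submodule.subset_span ⟨∅, p.1, hcs p hp, (mulMon_empty_bdryF _).symm⟩
  · intro f hf _
    by_cases hX : ∃ X, IsInitial K n ord f X
    · obtain ⟨X, hX⟩ := hX
      obtain ⟨p, hp, hsub⟩ := exists_erase_subset_of_isInitial ord k hR hrem hf hX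
      refine ⟨_, ⟨p, hp, rfl⟩, fun X' Y hX' hY => ?_⟩
      rwa [hX'.unique hX, hY.unique (hin p hp)]
    · obtain ⟨p, hp⟩ := List.exists_mem_of_ne_nil R hne
      exact ⟨_, ⟨p, hp, rfl⟩, fun X _ h => absurd ⟨X, h⟩ hX⟩
  · rintro _ ⟨p, hp, rfl⟩ Y hY
    rw [hY.unique (hin p hp), bdryF_apply_erase (hR p hp).1, (heven p hp).neg_one_pow]
  · rintro _ ⟨p, hp, rfl⟩ _ ⟨q, hq, rfl⟩ hpq Y hY X hX
    obtain ⟨i, hi, rfl⟩ := exists_erase_of_mem_support_bdryF hX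
    rw [hY.unique (hin p hp)]
    exact hred p hp q hq (fun h => hpq (h ▸ rfl)) i hi

end NormalForm

theorem forall_mem_exCircuits {p : Finset (Fin 6) → Prop} :
    (∀ C ∈ exCircuits, p C) ↔
      ∀ C ∈ [({4, 5, 1, 2} : Finset (Fin 6)), {4, 5, 0, 3}, {4, 0, 1, 2, 3}, {5, 0, 1, 2, 3}],
        p C := by
  simp [exCircuits]

/-- The three circuits of the first basis, with their minimum for `H ≺ P ≺ x ≺ y ≺ z ≺ t`. -/
def rulesHP : List (Finset (Fin 6) × Fin 6) :=
  [({4, 5, 1, 2}, 4), ({4, 5, 0, 3}, 4), ({4, 0, 1, 2, 3}, 4)]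

/-- The four circuits, with their minimum for `x ≺ y ≺ z ≺ t ≺ H ≺ P`. -/
def rulesXY : List (Finset (Fin 6) × Fin 6) :=
  [({4, 5, 1, 2}, 1), ({4, 5, 0, 3}, 0), ({4, 0, 1, 2, 3}, 0), ({5, 0, 1, 2, 3}, 0)]

theorem remCoeff_rulesHP_sum (X : Finset (Fin 6)) (hX : ∀ p ∈ rulesHP, ¬ p.1.erase p.2 ⊆ X)
    (C : Finset (Fin 6)) (hC : C ∈ exCircuits) (S : Finset (Fin 6))
    (hcard : S.card + C.card = X.card + 1) :
    ∑ i ∈ C, mulBdryCoeff S C i * remCoeff rulesHP 6 X (S ∪ C.erase i) = 0 := by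
  revert C S
  rw [forall_mem_exCircuits]
  revert X
  decide +kernel

theorem remCoeff_rulesXY_sum (X : Finset (Fin 6)) (hX : ∀ p ∈ rulesXY, ¬ p.1.erase p.2 ⊆ X)
    (C : Finset (Fin 6)) (hC : C ∈ exCircuits) (S : Finset (Fin 6))
    (hcard : S.card + C.card = X.card + 1) :
    ∑ i ∈ C, mulBdryCoeff S C i * remCoeff rulesXY 6 X (S ∪ C.erase i) = 0 := by
  revert C S
  rw [forall_mem_exCircuits]
  revert X
  decide +kernel

/-- For the matroid with circuits
`{H,P,y,z}, {H,P,x,t}, {H,x,y,z,t}, {P,x,y,z,t}` (with `x = 0, y = 1, z = 2, t = 3, H = 4,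
P = 5`): with respect to any monomial order whose restriction to generators is
`e_H ≺ e_P ≺ e_x ≺ e_y ≺ e_z ≺ e_t`, the boundaries of the three circuits
`{H,P,y,z}, {H,P,x,t}, {H,x,y,z,t}` form a reduced Gröbner basis of `I(M)_K`; whereas with
respect to any monomial order whose restriction to generators is
`e_x ≺ e_y ≺ e_z ≺ e_t ≺ e_H ≺ e_P`, the boundaries of all four circuits form a reduced
Gröbner basis of `I(M)_K`. -/
theorem stmt_15 (K : Type*) [Field K] :
    (∀ ord : MonOrder 6,
      ord.lt {4} {5} → ord.lt {5} {0} → ord.lt {0} {1} → ord.lt {1} {2} → ord.lt {2} {3} →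
      IsRedGB K 6 ord
        {bdryF K 6 ({4, 5, 1, 2} : Finset (Fin 6)),
         bdryF K 6 ({4, 5, 0, 3} : Finset (Fin 6)),
         bdryF K 6 ({4, 0, 1, 2, 3} : Finset (Fin 6))}
        (idealF K 6 exCircuits)) ∧
    (∀ ord : MonOrder 6,
      ord.lt {0} {1} → ord.lt {1} {2} → ord.lt {2} {3} → ord.lt {3} {4} → ord.lt {4} {5} →
      IsRedGB K 6 ord
        {bdryF K 6 ({4, 5, 1, 2} : Finset (Fin 6)),
         bdryF K 6 ({4, 5, 0, 3} : Finset (Fin 6)),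
         bdryF K 6 ({4, 0, 1, 2, 3} : Finset (Fin 6)),
         bdryF K 6 ({5, 0, 1, 2, 3} : Finset (Fin 6))}
        (idealF K 6 exCircuits)) := by
  constructor
  · intro ord h45 h50 h01 h12 h23
    have h40 := ord.trans _ _ _ h45 h50
    have h41 := ord.trans _ _ _ h40 h01
    have h42 := ord.trans _ _ _ h41 h12
    have h43 := ord.trans _ _ _ h42 h23
    have h := isRedGB_bdryF (K := K) ord (R := rulesHP) (cs := exCircuits) 6
      (by simp [rulesHP]) (by simp [rulesHP, exCircuits])
      (by simp [rulesHP, h40, h41, h42, h43, h45]) remCoeff_rulesHP_sum (by decide +kernel)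
      (by decide +kernel)
    convert h using 1
    ext g
    simp [rulesHP, eq_comm]
  · intro ord h01 h12 h23 h34 h45
    have h02 := ord.trans _ _ _ h01 h12
    have h03 := ord.trans _ _ _ h02 h23
    have h04 := ord.trans _ _ _ h03 h34
    have h05 := ord.trans _ _ _ h04 h45
    have h13 := ord.trans _ _ _ h12 h23
    have h14 := ord.trans _ _ _ h13 h34
    have h15 := ord.trans _ _ _ h14 h45
    have h := isRedGB_bdryF (K := K) ord (R := rulesXY) (cs := exCircuits) 6
      (by simp [rulesXY]) (by simp [rulesXY, exCircuits])
      (by simp [rulesXY, h01, h02, h03, h04, h05, h12, h14, h15]) remCoeff_rulesXY_sum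
      (by decide +kernel) (by decide +kernel)
    convert h using 1
    ext g
    simp [rulesXY, eq_comm]
end
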